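/- Let Ω ⊆ ℝ^N be an open set, p > 1, let a : ℝ^N → ℝ^N be a smooth divergence-free vector field, let u be a smooth positive solution of −Δu + a(x)·∇u = u^p in Ω, and let E be a smooth positive function on Ω satisfying −ΔE + a(x)·∇E ≥ p u^{p−1} E in Ω. Then for all real numbers T ≥ 1, 0 < β < 1, ε > 0, δ > 0, t > 1/2 and every nonnegative ψ ∈ C_c^∞(Ω) one has: (βp − T t²/(2t−1)) ∫_Ω u^{2t+p−1} ψ² dx + β(1−β−ε) ∫_Ω (|∇E|²/E²) u^{2t} ψ² dx + (T−1) ∫_Ω |∇(u^t ψ)|² dx ≤ (β/(4ε) + T t δ/(2t−1)) ∫_Ω |a|² u^{2t} ψ² dx + (T + T t/(4δ(2t−1))) ∫_Ω u^{2t} |∇ψ|² dx + (T|t−1|/(2(2t−1))) ∫_Ω u^{2t} |Δ(ψ²)| dx. -/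

import Mathlib

open MeasureTheory Real Filter
open scoped InnerProductSpace ENNReal Topology

noncomputable section

/-- Euclidean space ℝ^N. -/
abbrev Euc (N : ℕ) := EuclideanSpace ℝ (Fin N)

/-- The Laplacian of a real-valued function on ℝ^N, as the sum of
the second partial derivatives in the coordinate directions. -/
def lap {N : ℕ} (u : Euc N → ℝ) (x : Euc N) : ℝ :=
  ∑ i : Fin N,
    fderiv ℝ (fun y => fderiv ℝ u y (EuclideanSpace.single i 1)) x
      (EuclideanSpace.single i 1)

/-- The divergence of a vector field on ℝ^N. -/
def divg {N : ℕ} (a : Euc N → Euc N) (x : Euc N) : ℝ :=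
  ∑ i : Fin N, fderiv ℝ a x (EuclideanSpace.single i 1) i

/-- The advection term `a(x) · ∇u(x)`. -/
def adv {N : ℕ} (a : Euc N → Euc N) (u : Euc N → ℝ) (x : Euc N) : ℝ :=
  ⟪a x, gradient u x⟫_ℝ

/-- `u` is a positive smooth solution of `-Δu + a(x)·∇u = u^p` in the open set `Ω`. -/
def IsSolution {N : ℕ} (a : Euc N → Euc N) (p : ℝ) (Ω : Set (Euc N))
    (u : Euc N → ℝ) : Prop :=
  ContDiffOn ℝ (⊤ : ℕ∞) u Ω ∧ (∀ x ∈ Ω, 0 < u x) ∧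
    ∀ x ∈ Ω, -lap u x + adv a u x = u x ^ p

/-- `u` is a stable solution of `-Δu + a(x)·∇u = u^p` in `Ω`: it is a positive smooth
solution and there is a smooth positive `E` with `-ΔE + a(x)·∇E ≥ p u^(p-1) E` in `Ω`. -/
def IsStableSolution {N : ℕ} (a : Euc N → Euc N) (p : ℝ) (Ω : Set (Euc N))
    (u : Euc N → ℝ) : Prop :=
  IsSolution a p Ω u ∧
    ∃ E : Euc N → ℝ, ContDiffOn ℝ (⊤ : ℕ∞) E Ω ∧ (∀ x ∈ Ω, 0 < E x) ∧
      ∀ x ∈ Ω, p * u x ^ (p - 1) * E x ≤ -lap E x + adv a E x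

/-- The Joseph–Lundgren exponent for `N ≥ 11`. -/
def pJL (N : ℕ) : ℝ :=
  (((N : ℝ) - 2) ^ 2 - 4 * N + 8 * Real.sqrt ((N : ℝ) - 1)) /
    (((N : ℝ) - 2) * ((N : ℝ) - 10))

/-- partial derivative -/
def pd {N : ℕ} (i : Fin N) (f : Euc N → ℝ) (x : Euc N) : ℝ :=
  fderiv ℝ f x (EuclideanSpace.single i 1)

lemma gradient_apply_pd {N : ℕ} (f : Euc N → ℝ) (x : Euc N) (i : Fin N) :
    gradient f x i = pd i f x := by
  have h : ⟪gradient f x, EuclideanSpace.single i (1:ℝ)⟫_ℝ = pd i f x := by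
    unfold gradient pd
    exact InnerProductSpace.toDual_symm_apply
  rw [← h, EuclideanSpace.inner_single_right]
  simp

lemma norm_gradient_sq {N : ℕ} (f : Euc N → ℝ) (x : Euc N) :
    ‖gradient f x‖ ^ 2 = ∑ i, pd i f x ^ 2 := by
  rw [EuclideanSpace.real_norm_sq_eq]
  simp only [gradient_apply_pd]

lemma adv_eq {N : ℕ} (a : Euc N → Euc N) (f : Euc N → ℝ) (x : Euc N) :
    adv a f x = ∑ i, a x i * pd i f x := by
  unfold adv
  rw [PiLp.inner_apply]
  refine Finset.sum_congr rfl fun i _ => ?_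
  simp [gradient_apply_pd, mul_comm]

lemma lap_eq {N : ℕ} (f : Euc N → ℝ) (x : Euc N) :
    lap f x = ∑ i, pd i (pd i f) x := rfl

lemma pd_contDiffAt {N : ℕ} {f : Euc N → ℝ} {x : Euc N} (i : Fin N)
    (hf : ContDiffAt ℝ (⊤ : ℕ∞) f x) : ContDiffAt ℝ (⊤ : ℕ∞) (pd i f) x := by
  unfold pd
  exact (hf.fderiv_right (m := (⊤ : ℕ∞)) (by simp)).clm_apply contDiffAt_const

lemma pd_mul {N : ℕ} {f g : Euc N → ℝ} {x : Euc N} (i : Fin N)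
    (hf : DifferentiableAt ℝ f x) (hg : DifferentiableAt ℝ g x) :
    pd i (fun y => f y * g y) x = pd i f x * g x + f x * pd i g x := by
  unfold pd
  rw [fderiv_fun_mul hf hg]
  simp; ring

lemma pd_inv {N : ℕ} {g : Euc N → ℝ} {x : Euc N} (i : Fin N)
    (hg : DifferentiableAt ℝ g x) (h0 : g x ≠ 0) :
    pd i (fun y => (g y)⁻¹) x = - pd i g x / g x ^ 2 := by
  unfold pd
  have h : HasFDerivAt (fun y => (g y)⁻¹) _ x :=
    (hasDerivAt_inv h0).comp_hasFDerivAt x hg.hasFDerivAt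
  rw [h.fderiv]
  simp
  ring

lemma pd_rpow {N : ℕ} {f : Euc N → ℝ} {x : Euc N} (i : Fin N) (s : ℝ)
    (hf : DifferentiableAt ℝ f x) (h0 : 0 < f x) :
    pd i (fun y => f y ^ s) x = s * (f x ^ s / f x) * pd i f x := by
  unfold pd
  rw [(hf.hasFDerivAt.rpow_const (Or.inl h0.ne')).fderiv, Real.rpow_sub_one h0.ne']
  simp

lemma pd_sq {N : ℕ} {f : Euc N → ℝ} {x : Euc N} (i : Fin N)
    (hf : DifferentiableAt ℝ f x) :
    pd i (fun y => f y ^ 2) x = 2 * f x * pd i f x := by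
  unfold pd
  rw [(hf.hasFDerivAt.pow 2).fderiv]
  simp

lemma pd_coord {N : ℕ} {a : Euc N → Euc N} {x : Euc N} (i : Fin N)
    (ha : DifferentiableAt ℝ a x) :
    pd i (fun y => a y i) x = fderiv ℝ a x (EuclideanSpace.single i 1) i := by
  unfold pd
  have h := ((EuclideanSpace.proj i : Euc N →L[ℝ] ℝ).hasFDerivAt (x := a x)).comp x
    ha.hasFDerivAt
  have h2 : fderiv ℝ (fun y => a y i) x = _ := h.fderiv
  rw [h2]
  simp

lemma integrableOn_aux {N : ℕ} {Ω K : Set (Euc N)} (hK : IsCompact K) (hKΩ : K ⊆ Ω)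
    {f : Euc N → ℝ} (hf : ContinuousOn f Ω) (h0 : ∀ x, x ∉ K → f x = 0) :
    IntegrableOn f Ω := by
  have h1 : IntegrableOn f K := (hf.mono hKΩ).integrableOn_compact hK
  have h2 : Integrable f := by
    rw [← integrableOn_iff_integrable_of_support_subset (s := K)]
    · exact h1
    · intro x hx
      by_contra h
      exact hx (h0 x h)
  exact h2.integrableOn

lemma pd_zero_off {N : ℕ} {f : Euc N → ℝ} {x : Euc N} (i : Fin N) (hx : x ∉ tsupport f) :
    pd i f x = 0 := by
  have : f =ᶠ[𝓝 x] fun _ => 0 := notMem_tsupport_iff_eventuallyEq.1 hx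
  unfold pd
  rw [this.fderiv_eq]
  simp

lemma int_pd {N : ℕ} {Ω : Set (Euc N)} (hΩ : IsOpen Ω) {φ G : Euc N → ℝ}
    (hφ : ContDiff ℝ (⊤ : ℕ∞) φ) (hc : HasCompactSupport φ) (hs : tsupport φ ⊆ Ω)
    (hG : ContDiffOn ℝ (⊤ : ℕ∞) G Ω) (i : Fin N) :
    IntegrableOn (pd i (fun y => φ y * G y)) Ω ∧
      ∫ x in Ω, pd i (fun y => φ y * G y) x = 0 := by
  set F : Euc N → ℝ := fun y => φ y * G y with hF
  have hFc : HasCompactSupport F := hc.mul_right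
  have hFs : tsupport F ⊆ tsupport φ := tsupport_mul_subset_left
  have hFd : ContDiff ℝ (⊤ : ℕ∞) F := by
    rw [contDiff_iff_contDiffAt]
    intro x
    by_cases hx : x ∈ Ω
    · exact hφ.contDiffAt.mul (hG.contDiffAt (hΩ.mem_nhds hx))
    · have : F =ᶠ[𝓝 x] fun _ => 0 :=
        notMem_tsupport_iff_eventuallyEq.1 fun h => hx (hs (hFs h))
      exact contDiffAt_const.congr_of_eventuallyEq this
  have hcont : Continuous (pd i F) :=
    continuous_iff_continuousAt.2 fun x => (pd_contDiffAt i hFd.contDiffAt).continuousAt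
  have hpc : HasCompactSupport (pd i F) :=
    HasCompactSupport.intro hFc fun x hx => pd_zero_off i hx
  have hint : Integrable (pd i F) := hcont.integrable_of_hasCompactSupport hpc
  refine ⟨hint.integrableOn, ?_⟩
  rw [setIntegral_eq_integral_of_forall_compl_eq_zero
    (fun x hx => pd_zero_off i fun h => hx (hs (hFs h)))]
  have := integral_mul_fderiv_eq_neg_fderiv_mul_of_integrable (𝕜 := ℝ) (μ := (volume : Measure (Euc N)))
    (f := fun _ : Euc N => (1:ℝ)) (g := F) (v := EuclideanSpace.single i 1)
    (by simp) (by simp only [one_mul]; exact hint)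
    (by simpa using hFd.continuous.integrable_of_hasCompactSupport hFc)
    (by fun_prop) (fun x _ => hFd.differentiable (by simp) x)
  simpa [pd] using this

/-- The pointwise algebra for the stability step. -/
lemma step1_pt {ε β Q ψ r ai w eii : ℝ} (hε : 0 < ε) (hβ : 0 < β) :
    β * (Q * ψ) ^ 2 * (-eii + ai * r) + β * (1 - β - ε) * (r ^ 2 * (Q * ψ) ^ 2) ≤
      w ^ 2 + β / (4 * ε) * (ai ^ 2 * (Q * ψ) ^ 2)
        - β * (2 * (Q * ψ) * w * r + (Q * ψ) ^ 2 * (eii - r ^ 2)) := by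
  have h1 : 0 ≤ (w - β * (Q * ψ) * r) ^ 2 := sq_nonneg _
  have h2 : 0 ≤ β * ε * (Q * ψ) ^ 2 * (ai / (2 * ε) - r) ^ 2 := by positivity
  have h3 : β * ε * (Q * ψ) ^ 2 * (ai / (2 * ε) - r) ^ 2 =
      β / (4 * ε) * (ai ^ 2 * (Q * ψ) ^ 2) - β * (Q * ψ) ^ 2 * ai * r
        + β * ε * (Q * ψ) ^ 2 * r ^ 2 := by
    field_simp
    ring
  nlinarith

/-- The pointwise algebra for the test-function step. -/
lemma step2_pt {δ t Q ψ s ai ψi : ℝ} (hδ : 0 < δ) (ht : 1 / 2 < t)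
    {uii aii L : ℝ} :
    (t * Q * s * ψ + Q * ψi) ^ 2 ≤
      t ^ 2 / (2 * t - 1) * (Q ^ 2 * ψ ^ 2 * (-uii + ai * s))
      + t * δ / (2 * t - 1) * (ai ^ 2 * (Q * ψ) ^ 2)
      + (1 + t / (4 * δ * (2 * t - 1))) * (Q ^ 2 * ψi ^ 2)
      - (t - 1) / (2 * (2 * t - 1)) * (Q ^ 2 * L)
      + t / (2 * (2 * t - 1)) * (Q ^ 2 * ψ ^ 2 * aii)
      + t ^ 2 / (2 * t - 1) * (2 * ψ * ψi * (Q ^ 2 * s)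
          + ψ ^ 2 * ((2 * t - 1) * Q ^ 2 * s ^ 2 + Q ^ 2 * uii))
      - t / (2 * (2 * t - 1)) * (2 * ψ * ψi * (Q ^ 2 * ai)
          + ψ ^ 2 * (2 * t * Q ^ 2 * s * ai + Q ^ 2 * aii))
      + (t - 1) / (2 * (2 * t - 1)) * (L * Q ^ 2 + 2 * ψ * ψi * (2 * t * Q ^ 2 * s)) := by
  have hk : 0 < 2 * t - 1 := by linarith
  have h : 0 ≤ t / (2 * t - 1) * δ * Q ^ 2 * (ai * ψ - ψi / (2 * δ)) ^ 2 := by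
    have : 0 < t := by linarith
    positivity
  obtain ⟨k, rfl⟩ : ∃ k, t = (k + 1) / 2 := ⟨2 * t - 1, by ring⟩
  have hk1 : 2 * ((k + 1) / 2) - 1 = k := by ring
  rw [hk1] at hk h ⊢
  rw [← sub_nonneg]
  convert h using 1
  field_simp
  ring

/-- The pointwise inequality, summed over the coordinates. -/
lemma total_pt {N : ℕ} {ε β δ t T p Q ψ R Labs : ℝ} (hε : 0 < ε) (hβ : 0 < β) (hδ : 0 < δ)
    (ht : 1 / 2 < t) (hT : 1 ≤ T)
    (r s a w e2 u2 a2 g L DA DB DC DD : Fin N → ℝ)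
    (hw : ∀ i, w i = t * Q * s i * ψ + Q * g i)
    (hDA : ∀ i, DA i = 2 * (Q * ψ) * w i * r i + (Q * ψ) ^ 2 * (e2 i - r i ^ 2))
    (hDB : ∀ i, DB i = 2 * ψ * g i * (Q ^ 2 * s i)
          + ψ ^ 2 * ((2 * t - 1) * Q ^ 2 * s i ^ 2 + Q ^ 2 * u2 i))
    (hDC : ∀ i, DC i = 2 * ψ * g i * (Q ^ 2 * a i)
          + ψ ^ 2 * (2 * t * Q ^ 2 * s i * a i + Q ^ 2 * a2 i))
    (hDD : ∀ i, DD i = L i * Q ^ 2 + 2 * ψ * g i * (2 * t * Q ^ 2 * s i))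
    (hE : p * R ≤ ∑ i, (-e2 i + a i * r i))
    (hu : ∑ i, (-u2 i + a i * s i) = R)
    (ha : ∑ i, a2 i = 0) (hL : |∑ i, L i| = Labs) :
    0 ≤ (β / (4 * ε) + T * t * δ / (2 * t - 1)) * ((∑ i, a i ^ 2) * (Q * ψ) ^ 2)
      + (T + T * t / (4 * δ * (2 * t - 1))) * (Q ^ 2 * ∑ i, g i ^ 2)
      + T * |t - 1| / (2 * (2 * t - 1)) * (Q ^ 2 * Labs)
      - (β * p - T * t ^ 2 / (2 * t - 1)) * (R * (Q * ψ) ^ 2)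
      - β * (1 - β - ε) * ((∑ i, r i ^ 2) * (Q * ψ) ^ 2)
      - (T - 1) * (∑ i, w i ^ 2)
      + ∑ i, (-β * DA i + T * (t ^ 2 / (2 * t - 1) * DB i - t / (2 * (2 * t - 1)) * DC i
          + (t - 1) / (2 * (2 * t - 1)) * DD i)) := by
  have hk : 0 < 2 * t - 1 := by linarith
  have h1 := Finset.sum_le_sum fun i (_ : i ∈ Finset.univ) =>
    step1_pt (Q := Q) (ψ := ψ) (r := r i) (ai := a i) (w := w i) (eii := e2 i) hε hβ
  have h2 := Finset.sum_le_sum fun i (_ : i ∈ Finset.univ) =>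
    step2_pt (Q := Q) (ψ := ψ) (s := s i) (ai := a i) (ψi := g i) (uii := u2 i) (aii := a2 i)
      (L := L i) hδ ht
  simp only [← hDA, ← hDB, ← hDC, ← hDD, ← hw] at h1 h2
  simp only [Finset.sum_add_distrib, Finset.sum_sub_distrib, ← Finset.mul_sum, ← Finset.sum_mul]
    at h1 h2 hE hu ⊢
  rw [ha] at h2
  have h3 : β * (Q * ψ) ^ 2 * (p * R) ≤
      β * (Q * ψ) ^ 2 * (∑ i, -e2 i + ∑ i, a i * r i) :=
    mul_le_mul_of_nonneg_left hE (by positivity)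
  have h4 : - ((t - 1) / (2 * (2 * t - 1)) * (Q ^ 2 * ∑ i, L i)) ≤
      |t - 1| / (2 * (2 * t - 1)) * (Q ^ 2 * Labs) := by
    have : -((t - 1) * ∑ i, L i) ≤ |t - 1| * Labs := by
      rw [← hL, ← abs_mul]
      exact neg_le_abs _
    have h5 := mul_le_mul_of_nonneg_left this
      (show 0 ≤ Q ^ 2 / (2 * (2 * t - 1)) by positivity)
    calc _ = Q ^ 2 / (2 * (2 * t - 1)) * -((t - 1) * ∑ i, L i) := by ring
      _ ≤ _ := h5
      _ = _ := by ring
  rw [hu] at h2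
  have h6 := mul_le_mul_of_nonneg_left (h2.trans (by
    linarith [h4] :
      _ ≤ t ^ 2 / (2 * t - 1) * (Q ^ 2 * ψ ^ 2 * R)
      + t * δ / (2 * t - 1) * ((∑ i, a i ^ 2) * (Q * ψ) ^ 2)
      + (1 + t / (4 * δ * (2 * t - 1))) * (Q ^ 2 * ∑ i, g i ^ 2)
      + |t - 1| / (2 * (2 * t - 1)) * (Q ^ 2 * Labs)
      + t ^ 2 / (2 * t - 1) * (∑ i, DB i)
      - t / (2 * (2 * t - 1)) * (∑ i, DC i)
      + (t - 1) / (2 * (2 * t - 1)) * (∑ i, DD i))) (show 0 ≤ T by linarith)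
  have h7 := h1.trans' (add_le_add_left h3 _)
  have h8 := add_nonneg (sub_nonneg.2 h6) (sub_nonneg.2 h7)
  refine h8.trans_eq ?_
  ring

lemma nonneg_comb {N : ℕ} {Ω : Set (Euc N)} (hΩ : IsOpen Ω)
    {f1 f2 f3 f4 f5 f6 D : Euc N → ℝ}
    (h1 : IntegrableOn f1 Ω) (h2 : IntegrableOn f2 Ω) (h3 : IntegrableOn f3 Ω)
    (h4 : IntegrableOn f4 Ω) (h5 : IntegrableOn f5 Ω) (h6 : IntegrableOn f6 Ω)
    (hD : IntegrableOn D Ω) (hD0 : ∫ x in Ω, D x = 0) (c1 c2 c3 c4 c5 c6 : ℝ)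
    (h : ∀ x ∈ Ω, 0 ≤ c4 * f4 x + c5 * f5 x + c6 * f6 x - c1 * f1 x - c2 * f2 x - c3 * f3 x
      + D x) :
    c1 * (∫ x in Ω, f1 x) + c2 * (∫ x in Ω, f2 x) + c3 * (∫ x in Ω, f3 x) ≤
      c4 * (∫ x in Ω, f4 x) + c5 * (∫ x in Ω, f5 x) + c6 * (∫ x in Ω, f6 x) := by
  have h0 := setIntegral_nonneg (μ := volume) hΩ.measurableSet h
  have i1 := h1.const_mul c1
  have i2 := h2.const_mul c2
  have i3 := h3.const_mul c3
  have i4 := h4.const_mul c4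
  have i5 := h5.const_mul c5
  have i6 := h6.const_mul c6
  have j1 : IntegrableOn (fun x => c4 * f4 x + c5 * f5 x) Ω := i4.add i5
  have j2 : IntegrableOn (fun x => c4 * f4 x + c5 * f5 x + c6 * f6 x) Ω := j1.add i6
  have j3 : IntegrableOn (fun x => c4 * f4 x + c5 * f5 x + c6 * f6 x - c1 * f1 x) Ω := j2.sub i1
  have j4 : IntegrableOn (fun x => c4 * f4 x + c5 * f5 x + c6 * f6 x - c1 * f1 x
    - c2 * f2 x) Ω := j3.sub i2
  have j5 : IntegrableOn (fun x => c4 * f4 x + c5 * f5 x + c6 * f6 x - c1 * f1 x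
    - c2 * f2 x - c3 * f3 x) Ω := j4.sub i3
  rw [integral_add j5 hD, integral_sub j4 i3, integral_sub j3 i2, integral_sub j2 i1,
    integral_add j1 i6, integral_add i4 i5] at h0
  simp only [integral_const_mul, hD0] at h0
  linarith

lemma comb4 {N : ℕ} {Ω : Set (Euc N)} {f1 f2 f3 f4 : Euc N → ℝ}
    (h1 : IntegrableOn f1 Ω ∧ ∫ x in Ω, f1 x = 0) (h2 : IntegrableOn f2 Ω ∧ ∫ x in Ω, f2 x = 0)
    (h3 : IntegrableOn f3 Ω ∧ ∫ x in Ω, f3 x = 0) (h4 : IntegrableOn f4 Ω ∧ ∫ x in Ω, f4 x = 0)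
    (b T c2 c3 c4 : ℝ) :
    ∫ x in Ω, (b * f1 x + T * (c2 * f2 x - c3 * f3 x + c4 * f4 x)) = 0 := by
  have i1 : IntegrableOn (fun x => b * f1 x) Ω := h1.1.const_mul b
  have i2 : IntegrableOn (fun x => c2 * f2 x) Ω := h2.1.const_mul c2
  have i3 : IntegrableOn (fun x => c3 * f3 x) Ω := h3.1.const_mul c3
  have i4 : IntegrableOn (fun x => c4 * f4 x) Ω := h4.1.const_mul c4
  have i5 : IntegrableOn (fun x => c2 * f2 x - c3 * f3 x) Ω := i2.sub i3
  have i6 : IntegrableOn (fun x => c2 * f2 x - c3 * f3 x + c4 * f4 x) Ω := i5.add i4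
  rw [integral_add i1 (i6.const_mul T), integral_const_mul, integral_const_mul,
    integral_add i5 i4, integral_sub i2 i3]
  simp only [integral_const_mul, h1.2, h2.2, h3.2, h4.2]
  simp


/-- The key energy estimate (Proposition 1 of the paper) for smooth
positive stable solutions of `-Δu + a·∇u = u^p` in an open set `Ω`, with a smooth
divergence-free advection `a`, valid for all `T ≥ 1`, `0 < β < 1`, `ε > 0`, `δ > 0`,
`t > 1/2` and every nonnegative test function `ψ ∈ C_c^∞(Ω)`. -/
theorem energy_estimate (N : ℕ) (Ω : Set (Euc N)) (hΩ : IsOpen Ω) (p : ℝ)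
    (hp : 1 < p) (a : Euc N → Euc N) (ha : ContDiff ℝ (⊤ : ℕ∞) a)
    (hdiv : ∀ x, divg a x = 0)
    (u : Euc N → ℝ) (hu : IsSolution a p Ω u)
    (E : Euc N → ℝ) (hE : ContDiffOn ℝ (⊤ : ℕ∞) E Ω) (hEpos : ∀ x ∈ Ω, 0 < E x)
    (hstab : ∀ x ∈ Ω, p * u x ^ (p - 1) * E x ≤ -lap E x + adv a E x)
    (T β ε δ t : ℝ) (hT : 1 ≤ T) (hβ : 0 < β) (hβ1 : β < 1) (hε : 0 < ε)
    (hδ : 0 < δ) (ht : 1 / 2 < t)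
    (ψ : Euc N → ℝ) (hψsmooth : ContDiff ℝ (⊤ : ℕ∞) ψ) (hψsupp : HasCompactSupport ψ)
    (hψΩ : tsupport ψ ⊆ Ω) (hψpos : ∀ x, 0 ≤ ψ x) :
    (β * p - T * t ^ 2 / (2 * t - 1)) *
        (∫ x in Ω, u x ^ (2 * t + p - 1) * ψ x ^ 2) +
      β * (1 - β - ε) *
        (∫ x in Ω, ‖gradient E x‖ ^ 2 / E x ^ 2 * u x ^ (2 * t) * ψ x ^ 2) +
      (T - 1) * (∫ x in Ω, ‖gradient (fun y => u y ^ t * ψ y) x‖ ^ 2) ≤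
    (β / (4 * ε) + T * t * δ / (2 * t - 1)) *
        (∫ x in Ω, ‖a x‖ ^ 2 * u x ^ (2 * t) * ψ x ^ 2) +
      (T + T * t / (4 * δ * (2 * t - 1))) *
        (∫ x in Ω, u x ^ (2 * t) * ‖gradient ψ x‖ ^ 2) +
      T * |t - 1| / (2 * (2 * t - 1)) *
        (∫ x in Ω, u x ^ (2 * t) * |lap (fun y => ψ y ^ 2) x|) := by
  obtain ⟨hu, hupos, hueq⟩ := hu
  have cdu : ∀ x ∈ Ω, ContDiffAt ℝ (⊤ : ℕ∞) u x := fun x hx => hu.contDiffAt (hΩ.mem_nhds hx)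
  have cdE : ∀ x ∈ Ω, ContDiffAt ℝ (⊤ : ℕ∞) E x := fun x hx => hE.contDiffAt (hΩ.mem_nhds hx)
  have cdψ : ∀ x, ContDiffAt ℝ (⊤ : ℕ∞) ψ x := fun x => hψsmooth.contDiffAt
  have cda : ∀ i x, ContDiffAt ℝ (⊤ : ℕ∞) (fun y => a y i) x := fun i x =>
    (contDiff_euclidean.1 ha i).contDiffAt
  have cdup : ∀ (s : ℝ), ∀ x ∈ Ω, ContDiffAt ℝ (⊤ : ℕ∞) (fun y => u y ^ s) x := fun s x hx =>
    (cdu x hx).rpow_const_of_ne (hupos x hx).ne'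
  have cdψ2 : ContDiff ℝ (⊤ : ℕ∞) (fun y => ψ y ^ 2) := hψsmooth.pow 2
  have cdw : ∀ x ∈ Ω, ContDiffAt ℝ (⊤ : ℕ∞) (fun y => u y ^ t * ψ y) x := fun x hx =>
    (cdup t x hx).mul (cdψ x)
  have hts : tsupport (fun y => ψ y ^ 2) ⊆ tsupport ψ := by
    have : (fun y => ψ y ^ 2) = fun y => ψ y * ψ y := by ext y; ring
    rw [this]
    exact tsupport_mul_subset_left
  have hψ2c : HasCompactSupport (fun y => ψ y ^ 2) :=
    HasCompactSupport.intro hψsupp fun x hx => by simp [image_eq_zero_of_notMem_tsupport hx]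
  have hpts : ∀ i, tsupport (pd i (fun y => ψ y ^ 2)) ⊆ tsupport ψ := fun i =>
    closure_minimal (fun x hx => by
      by_contra h
      exact hx (pd_zero_off i fun h' => h (hts h'))) (isClosed_tsupport ψ)
  have hpcd : ∀ i, ContDiff ℝ (⊤ : ℕ∞) (pd i (fun y => ψ y ^ 2)) := fun i =>
    contDiff_iff_contDiffAt.2 fun x => pd_contDiffAt i cdψ2.contDiffAt
  have hpc : ∀ i, HasCompactSupport (pd i (fun y => ψ y ^ 2)) := fun i =>
    HasCompactSupport.intro hψsupp fun x hx => pd_zero_off i fun h' => hx (hts h')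
  have hwts : tsupport (fun y => u y ^ t * ψ y) ⊆ tsupport ψ := tsupport_mul_subset_right
  have iA := fun i => int_pd hΩ cdψ2 hψ2c (hts.trans hψΩ)
    (G := fun y => u y ^ (2 * t) * (pd i E y * (E y)⁻¹)) (fun x hx =>
      ((cdup _ x hx).mul ((pd_contDiffAt i (cdE x hx)).mul
        ((cdE x hx).inv (hEpos x hx).ne'))).contDiffWithinAt) i
  have iB := fun i => int_pd hΩ cdψ2 hψ2c (hts.trans hψΩ)
    (G := fun y => u y ^ (2 * t - 1) * pd i u y) (fun x hx =>
      ((cdup _ x hx).mul (pd_contDiffAt i (cdu x hx))).contDiffWithinAt) i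
  have iC := fun i => int_pd hΩ cdψ2 hψ2c (hts.trans hψΩ)
    (G := fun y => u y ^ (2 * t) * a y i) (fun x hx =>
      ((cdup _ x hx).mul (cda i x)).contDiffWithinAt) i
  have iD := fun i => int_pd hΩ (hpcd i) (hpc i) ((hpts i).trans hψΩ)
    (G := fun y => u y ^ (2 * t)) (fun x hx => (cdup _ x hx).contDiffWithinAt) i
  set DA : Fin N → Euc N → ℝ := fun i =>
    pd i fun y => ψ y ^ 2 * (u y ^ (2 * t) * (pd i E y * (E y)⁻¹)) with hDA
  set DB : Fin N → Euc N → ℝ := fun i =>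
    pd i fun y => ψ y ^ 2 * (u y ^ (2 * t - 1) * pd i u y) with hDB
  set DC : Fin N → Euc N → ℝ := fun i =>
    pd i fun y => ψ y ^ 2 * (u y ^ (2 * t) * a y i) with hDC
  set DD : Fin N → Euc N → ℝ := fun i =>
    pd i fun y => pd i (fun y => ψ y ^ 2) y * u y ^ (2 * t) with hDD
  have jA : ∀ i, IntegrableOn (DA i) Ω ∧ ∫ x in Ω, DA i x = 0 := iA
  have jB : ∀ i, IntegrableOn (DB i) Ω ∧ ∫ x in Ω, DB i x = 0 := iB
  have jC : ∀ i, IntegrableOn (DC i) Ω ∧ ∫ x in Ω, DC i x = 0 := iC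
  have jD : ∀ i, IntegrableOn (DD i) Ω ∧ ∫ x in Ω, DD i x = 0 := iD
  have kD : ∀ i, IntegrableOn (fun x => -β * DA i x + T * (t ^ 2 / (2 * t - 1) * DB i x
      - t / (2 * (2 * t - 1)) * DC i x + (t - 1) / (2 * (2 * t - 1)) * DD i x)) Ω := fun i =>
    ((jA i).1.const_mul _).add (((((jB i).1.const_mul _).sub ((jC i).1.const_mul _)).add
      ((jD i).1.const_mul _)).const_mul _)
  have contu : ∀ s : ℝ, ContinuousOn (fun y => u y ^ s) Ω := fun s x hx =>
    (cdup s x hx).continuousAt.continuousWithinAt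
  have contψ : ContinuousOn ψ Ω := hψsmooth.continuous.continuousOn
  have contE : ContinuousOn E Ω := hE.continuousOn
  have conta : ContinuousOn a Ω := ha.continuous.continuousOn
  have contpE : ∀ i, ContinuousOn (pd i E) Ω := fun i x hx =>
    (pd_contDiffAt i (cdE x hx)).continuousAt.continuousWithinAt
  have contpψ : ∀ i, ContinuousOn (pd i ψ) Ω := fun i x hx =>
    (pd_contDiffAt i (cdψ x)).continuousAt.continuousWithinAt
  have contpw : ∀ i, ContinuousOn (pd i (fun y => u y ^ t * ψ y)) Ω := fun i x hx =>
    (pd_contDiffAt i (cdw x hx)).continuousAt.continuousWithinAt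
  have contL : ∀ i, ContinuousOn (pd i (pd i (fun y => ψ y ^ 2))) Ω := fun i x hx =>
    (pd_contDiffAt i (hpcd i).contDiffAt).continuousAt.continuousWithinAt
  have hψ0 : ∀ x, x ∉ tsupport ψ → ψ x = 0 := fun x hx => image_eq_zero_of_notMem_tsupport hx
  refine nonneg_comb hΩ
    (D := fun x => ∑ i, (-β * DA i x + T * (t ^ 2 / (2 * t - 1) * DB i x
      - t / (2 * (2 * t - 1)) * DC i x + (t - 1) / (2 * (2 * t - 1)) * DD i x)))
    ?_ ?_ ?_ ?_ ?_ ?_ ?_ ?_ _ _ _ _ _ _ ?_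
  · exact integrableOn_aux hψsupp hψΩ ((contu _).mul (contψ.pow 2))
      (fun x hx => by simp [hψ0 x hx])
  · simp only [norm_gradient_sq]
    exact integrableOn_aux hψsupp hψΩ ((((continuousOn_finsetSum _
      fun i _ => (contpE i).pow 2).div (contE.pow 2)
      fun x hx => (pow_pos (hEpos x hx) 2).ne').mul (contu _)).mul (contψ.pow 2))
      (fun x hx => by simp [hψ0 x hx])
  · simp only [norm_gradient_sq]
    exact integrableOn_aux hψsupp hψΩ (continuousOn_finsetSum _
      fun i _ => (contpw i).pow 2)
      (fun x hx => Finset.sum_eq_zero fun i _ => by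
        rw [pd_zero_off i fun h => hx (hwts h)]; simp)
  · exact integrableOn_aux hψsupp hψΩ (((conta.norm.pow 2).mul (contu _)).mul (contψ.pow 2))
      (fun x hx => by simp [hψ0 x hx])
  · simp only [norm_gradient_sq]
    exact integrableOn_aux hψsupp hψΩ ((contu _).mul (continuousOn_finsetSum _
      fun i _ => (contpψ i).pow 2))
      (fun x hx => by
        rw [Finset.sum_eq_zero fun i _ => by rw [pd_zero_off i hx]; simp]; simp)
  · simp only [lap_eq]
    exact integrableOn_aux hψsupp hψΩ ((contu _).mul (continuousOn_finsetSum _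
      fun i _ => contL i).abs)
      (fun x hx => by
        rw [Finset.sum_eq_zero fun i _ => pd_zero_off i fun h => hx (hpts i h)]; simp)
  · exact integrable_finsetSum _ fun i _ => kD i
  · rw [integral_finsetSum _ fun i _ => kD i]
    refine Finset.sum_eq_zero fun i _ => ?_
    exact comb4 (jA i) (jB i) (jC i) (jD i) _ _ _ _ _
  · intro x hx
    have hU := hupos x hx
    have he := hEpos x hx
    have du : DifferentiableAt ℝ u x := (cdu x hx).differentiableAt (by simp)
    have dE : DifferentiableAt ℝ E x := (cdE x hx).differentiableAt (by simp)
    have dψ : DifferentiableAt ℝ ψ x := (cdψ x).differentiableAt (by simp)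
    have dψ2 : DifferentiableAt ℝ (fun y => ψ y ^ 2) x :=
      cdψ2.contDiffAt.differentiableAt (by simp)
    have dpψ2 : ∀ i, DifferentiableAt ℝ (pd i (fun y => ψ y ^ 2)) x := fun i =>
      (hpcd i).contDiffAt.differentiableAt (by simp)
    have dpu : ∀ i, DifferentiableAt ℝ (pd i u) x := fun i =>
      (pd_contDiffAt i (cdu x hx)).differentiableAt (by simp)
    have dpE : ∀ i, DifferentiableAt ℝ (pd i E) x := fun i =>
      (pd_contDiffAt i (cdE x hx)).differentiableAt (by simp)
    have dEi : DifferentiableAt ℝ (fun y => (E y)⁻¹) x := dE.fun_inv he.ne'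
    have dup : ∀ s : ℝ, DifferentiableAt ℝ (fun y => u y ^ s) x := fun s =>
      (cdup s x hx).differentiableAt (by simp)
    have dai : ∀ i, DifferentiableAt ℝ (fun y => a y i) x := fun i =>
      (cda i x).differentiableAt (by simp)
    have da : DifferentiableAt ℝ a x := ha.contDiffAt.differentiableAt (by simp)
    have e1 : u x ^ (2 * t) = (u x ^ t) ^ 2 := by
      rw [mul_comm, Real.rpow_mul hU.le]; norm_num
    have e2 : u x ^ (2 * t - 1) = (u x ^ t) ^ 2 / u x := by
      rw [Real.rpow_sub_one hU.ne', e1]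
    have e3 : u x ^ (2 * t + p - 1) = (u x ^ t) ^ 2 * u x ^ (p - 1) := by
      rw [← e1, ← Real.rpow_add hU]; ring_nf
    have e4 : u x ^ p = u x * u x ^ (p - 1) := by
      rw [Real.rpow_sub_one hU.ne']; field_simp
    have key := total_pt (p := p) (Q := u x ^ t) (ψ := ψ x) (R := u x ^ (p - 1)) hε hβ hδ ht hT
      (fun i => pd i E x / E x) (fun i => pd i u x / u x) (fun i => a x i)
      (fun i => pd i (fun y => u y ^ t * ψ y) x) (fun i => pd i (pd i E) x / E x)
      (fun i => pd i (pd i u) x / u x) (fun i => pd i (fun y => a y i) x)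
      (fun i => pd i ψ x) (fun i => pd i (pd i (fun y => ψ y ^ 2)) x)
      (fun i => DA i x) (fun i => DB i x) (fun i => DC i x) (fun i => DD i x)
      ?_ ?_ ?_ ?_ ?_ ?_ ?_ ?_ rfl
    · convert key using 1
      simp only [norm_gradient_sq, lap_eq, e1, e3, div_pow, ← Finset.sum_div]
      rw [EuclideanSpace.real_norm_sq_eq]
      ring
    · intro i
      rw [pd_mul i (dup t) dψ, pd_rpow i t du hU]
      ring
    · intro i
      simp only [hDA]
      rw [pd_mul i dψ2 ((dup _).fun_mul ((dpE i).fun_mul dEi)), pd_sq i dψ,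
        pd_mul i (dup _) ((dpE i).fun_mul dEi), pd_mul i (dpE i) dEi, pd_inv i dE he.ne',
        pd_rpow i _ du hU, pd_mul i (dup t) dψ, pd_rpow i t du hU, e1]
      field_simp
      ring
    · intro i
      simp only [hDB]
      rw [pd_mul i dψ2 ((dup _).fun_mul (dpu i)), pd_sq i dψ,
        pd_mul i (dup _) (dpu i), pd_rpow i _ du hU, e2]
      field_simp
    · intro i
      simp only [hDC]
      rw [pd_mul i dψ2 ((dup _).fun_mul (dai i)), pd_sq i dψ,
        pd_mul i (dup _) (dai i), pd_rpow i _ du hU, e1]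
      field_simp
    · intro i
      simp only [hDD]
      rw [pd_mul i (dpψ2 i) (dup _), pd_sq i dψ, pd_rpow i _ du hU, e1]
      field_simp
    · have h := hstab x hx
      rw [lap_eq, adv_eq] at h
      have h' : ∑ i, (-(pd i (pd i E) x / E x) + a x i * (pd i E x / E x)) =
          (-∑ i, pd i (pd i E) x + ∑ i, a x i * pd i E x) / E x := by
        rw [add_div, neg_div, Finset.sum_div, Finset.sum_div, ← Finset.sum_neg_distrib,
          ← Finset.sum_add_distrib]
        exact Finset.sum_congr rfl fun i _ => by ring
      rw [h', le_div_iff₀ he]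
      exact h
    · have h := hueq x hx
      rw [lap_eq, adv_eq] at h
      have h' : ∑ i, (-(pd i (pd i u) x / u x) + a x i * (pd i u x / u x)) =
          (-∑ i, pd i (pd i u) x + ∑ i, a x i * pd i u x) / u x := by
        rw [add_div, neg_div, Finset.sum_div, Finset.sum_div, ← Finset.sum_neg_distrib,
          ← Finset.sum_add_distrib]
        exact Finset.sum_congr rfl fun i _ => by ring
      rw [h', h, e4]
      field_simp
    · rw [← hdiv x]
      unfold divg
      exact Finset.sum_congr rfl fun i _ => pd_coord i da
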